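/- arXiv:math/0412352 — 2 statements merged into one kernel-verified Lean document; each statement's English description precedes it below -/
import Mathlib

section
/- Let C_* be a symplectic chain complex of finite-dimensional real vector spaces. For each p, the bilinear map [ω_{p,n-p}] : H_p(C) × H_{n-p}(C) → ℝ given by [ω_{p,n-p}]([x],[y]) = ω_{p,n-p}(x,y) (for cycles x ∈ ker ∂_p, y ∈ ker ∂_{n-p}) is well defined — that is, ω_{p,n-p}(x,y) = ω_{p,n-p}(x',y') whenever x − x' ∈ Im ∂_{p+1} and y − y' ∈ Im ∂_{n-p+1} — and it is anti-symmetric in the sense that [ω_{p,n-p}]([x],[y]) = (-1)^{p(n-p)} [ω_{n-p,p}]([y],[x]), and non-degenerate. -/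
open Finset

noncomputable section

def Zmod (C : ℕ → Type) [∀ p, AddCommGroup (C p)] [∀ p, Module ℝ (C p)]
    (d : ∀ p, C (p+1) →ₗ[ℝ] C p) : ∀ p, Submodule ℝ (C p)
  | 0 => ⊤
  | (p+1) => LinearMap.ker (d p)

def Bmod (C : ℕ → Type) [∀ p, AddCommGroup (C p)] [∀ p, Module ℝ (C p)]
    (d : ∀ p, C (p+1) →ₗ[ℝ] C p) (p : ℕ) : Submodule ℝ (C p) :=
  LinearMap.range (d p)

abbrev Hsub (C : ℕ → Type) [∀ p, AddCommGroup (C p)] [∀ p, Module ℝ (C p)]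
    (d : ∀ p, C (p+1) →ₗ[ℝ] C p) (p : ℕ) : Submodule ℝ (Zmod C d p) :=
  Submodule.comap (Zmod C d p).subtype (Bmod C d p)

abbrev Hmod (C : ℕ → Type) [∀ p, AddCommGroup (C p)] [∀ p, Module ℝ (C p)]
    (d : ∀ p, C (p+1) →ₗ[ℝ] C p) (p : ℕ) : Type :=
  Zmod C d p ⧸ Hsub C d p
section PairingLemmas

variable {n : ℕ} {C : ℕ → Type} [∀ p, AddCommGroup (C p)] [∀ p, Module ℝ (C p)]
  {d : ∀ p, C (p+1) →ₗ[ℝ] C p} {ω : ∀ p q, C p →ₗ[ℝ] C q →ₗ[ℝ] ℝ}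

/-- Boundaries pair to zero with cycles. -/
theorem pairing_boundary_cycle_eq_zero
    (hlen : ∀ p, n < p → Subsingleton (C p))
    (hcompat : ∀ p q, p + (q+1) = n → ∀ (a : C (p+1)) (b : C (q+1)),
      ω p (q+1) (d p a) b = (-1 : ℝ) ^ (p+1) * ω (p+1) q a (d q b))
    {p q : ℕ} (hpq : p + q = n) {x : C p} (hx : x ∈ Bmod C d p)
    {y : C q} (hy : y ∈ Zmod C d q) : ω p q x y = 0 := by
  obtain ⟨a, rfl⟩ := hx
  cases q with
  | zero =>
    have := hlen (p + 1) (by omega)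
    simp [Subsingleton.elim a 0]
  | succ q =>
    have hy' : d q y = 0 := hy
    simp [hcompat p q hpq, hy']

/-- An element pairing to zero with all cycles of complementary degree is a boundary. -/
theorem mem_boundary_of_pairing_cycles_eq_zero [∀ p, FiniteDimensional ℝ (C p)]
    (hnd₁ : ∀ p q, p + q = n → ∀ a : C p, (∀ b : C q, ω p q a b = 0) → a = 0)
    (hnd₂ : ∀ p q, p + q = n → ∀ b : C q, (∀ a : C p, ω p q a b = 0) → b = 0)
    (hcompat : ∀ p q, p + (q+1) = n → ∀ (a : C (p+1)) (b : C (q+1)),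
      ω p (q+1) (d p a) b = (-1 : ℝ) ^ (p+1) * ω (p+1) q a (d q b))
    {p q : ℕ} (hpq : p + q = n) {x : C p}
    (hx : ∀ y ∈ Zmod C d q, ω p q x y = 0) : x ∈ Bmod C d p := by
  cases q with
  | zero =>
    rw [hnd₁ p 0 hpq x fun b => hx b Submodule.mem_top]
    exact zero_mem _
  | succ q =>
    have hann : ω p (q+1) x ∈ (LinearMap.ker (d q)).dualAnnihilator :=
      (Submodule.mem_dualAnnihilator _).mpr hx
    rw [← LinearMap.range_dualMap_eq_dualAnnihilator_ker] at hann
    obtain ⟨φ, hφ⟩ := hann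
    have hpq' : p + 1 + q = n := by omega
    have hsurj : Function.Surjective (ω (p+1) q) := by
      rw [← LinearMap.flip_injective_iff₂, injective_iff_map_eq_zero]
      exact fun b hb => hnd₂ (p+1) q hpq' b fun a => LinearMap.congr_fun hb a
    obtain ⟨a, rfl⟩ := hsurj φ
    refine ⟨(-1 : ℝ) ^ (p+1) • a, (sub_eq_zero.mp (hnd₁ p (q+1) hpq _ fun b => ?_))⟩
    have hb : ω (p+1) q a (d q b) = ω p (q+1) x b := LinearMap.congr_fun hφ b
    rw [map_sub, LinearMap.sub_apply, hcompat p q hpq, map_smul, LinearMap.smul_apply, hb,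
      smul_eq_mul, ← mul_assoc, ← mul_pow]
    simp

end PairingLemmas

/-- The pairing induced on homology by the pairings of a symplectic chain complex is
well defined on homology classes, anti-symmetric, and non-degenerate. -/
theorem induced_homology_pairing_well_defined_antisymmetric_nondegenerate
    (n : ℕ) (hn : n % 4 = 2)
    (C : ℕ → Type) [∀ p, AddCommGroup (C p)] [∀ p, Module ℝ (C p)]
    [∀ p, FiniteDimensional ℝ (C p)]
    (d : ∀ p, C (p+1) →ₗ[ℝ] C p)
    (hdd : ∀ p, (d p).comp (d (p+1)) = 0)
    (hlen : ∀ p, n < p → Subsingleton (C p))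
    (ω : ∀ p q, C p →ₗ[ℝ] C q →ₗ[ℝ] ℝ)
    (hanti : ∀ p q, p + q = n → ∀ (a : C p) (b : C q),
      ω p q a b = (-1 : ℝ) ^ (p * q) * ω q p b a)
    (hnd₁ : ∀ p q, p + q = n → ∀ a : C p, (∀ b : C q, ω p q a b = 0) → a = 0)
    (hnd₂ : ∀ p q, p + q = n → ∀ b : C q, (∀ a : C p, ω p q a b = 0) → b = 0)
    (hcompat : ∀ p q, p + (q+1) = n → ∀ (a : C (p+1)) (b : C (q+1)),
      ω p (q+1) (d p a) b = (-1 : ℝ) ^ (p+1) * ω (p+1) q a (d q b)) :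
    -- well-definedness on homology classes
    (∀ p q, p + q = n → ∀ x x' : C p, ∀ y y' : C q,
      x ∈ Zmod C d p → x' ∈ Zmod C d p → y ∈ Zmod C d q → y' ∈ Zmod C d q →
      x - x' ∈ Bmod C d p → y - y' ∈ Bmod C d q →
      ω p q x y = ω p q x' y') ∧
    -- anti-symmetry of the induced pairing
    (∀ p q, p + q = n → ∀ x ∈ Zmod C d p, ∀ y ∈ Zmod C d q,
      ω p q x y = (-1 : ℝ) ^ (p * q) * ω q p y x) ∧
    -- non-degeneracy of the induced pairing
    (∀ p q, p + q = n → ∀ x ∈ Zmod C d p,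
      (∀ y ∈ Zmod C d q, ω p q x y = 0) → x ∈ Bmod C d p) ∧
    (∀ p q, p + q = n → ∀ y ∈ Zmod C d q,
      (∀ x ∈ Zmod C d p, ω p q x y = 0) → y ∈ Bmod C d q) := by
  have hzero : ∀ p q, p + q = n → ∀ x ∈ Bmod C d p, ∀ y ∈ Zmod C d q, ω p q x y = 0 :=
    fun p q hpq x hx y hy => pairing_boundary_cycle_eq_zero hlen hcompat hpq hx hy
  refine ⟨fun p q hpq x x' y y' _ hx' hy _ hxx hyy => ?_,
    fun p q hpq x _ y _ => hanti p q hpq x y,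
    fun p q hpq x _ hx => mem_boundary_of_pairing_cycles_eq_zero hnd₁ hnd₂ hcompat hpq hx,
    fun p q hpq y _ hy => ?_⟩
  · have h₁ := hzero p q hpq _ hxx y hy
    have h₂ : ω p q x' (y - y') = 0 := by
      rw [hanti p q hpq, hzero q p (by omega) _ hyy x' hx', mul_zero]
    rw [map_sub, LinearMap.sub_apply] at h₁
    rw [map_sub] at h₂
    linarith
  · have hqp : q + p = n := by omega
    refine mem_boundary_of_pairing_cycles_eq_zero hnd₁ hnd₂ hcompat hqp fun x hx => ?_
    rw [hanti q p hqp, hy x hx, mul_zero]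
end
end

section
/- Let C_* be a symplectic chain complex of finite-dimensional real vector spaces and fix p with 0 ≤ p ≤ n. If y_0 ∈ ker ∂_{n-p} satisfies ω_{p,n-p}(x, y_0) = 0 for all x ∈ ker ∂_p, then y_0 ∈ Im ∂_{n-p+1}. -/
open Finset

noncomputable section

/-- In a symplectic chain complex, if a cycle `y₀ ∈ ker ∂_{n-p}` pairs trivially with
every cycle of `ker ∂_p`, then `y₀` is a boundary, `y₀ ∈ Im ∂_{n-p+1}`. -/
theorem cycle_pairing_trivially_with_all_cycles_is_boundary
    (n : ℕ) (hn : n % 4 = 2)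
    (C : ℕ → Type) [∀ p, AddCommGroup (C p)] [∀ p, Module ℝ (C p)]
    [∀ p, FiniteDimensional ℝ (C p)]
    (d : ∀ p, C (p+1) →ₗ[ℝ] C p)
    (hdd : ∀ p, (d p).comp (d (p+1)) = 0)
    (hlen : ∀ p, n < p → Subsingleton (C p))
    (ω : ∀ p q, C p →ₗ[ℝ] C q →ₗ[ℝ] ℝ)
    (hanti : ∀ p q, p + q = n → ∀ (a : C p) (b : C q),
      ω p q a b = (-1 : ℝ) ^ (p * q) * ω q p b a)
    (hnd₁ : ∀ p q, p + q = n → ∀ a : C p, (∀ b : C q, ω p q a b = 0) → a = 0)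
    (hnd₂ : ∀ p q, p + q = n → ∀ b : C q, (∀ a : C p, ω p q a b = 0) → b = 0)
    (hcompat : ∀ p q, p + (q+1) = n → ∀ (a : C (p+1)) (b : C (q+1)),
      ω p (q+1) (d p a) b = (-1 : ℝ) ^ (p+1) * ω (p+1) q a (d q b))
    (p q : ℕ) (hpq : p + q = n)
    (y₀ : C q) (hy₀ : y₀ ∈ Zmod C d q)
    (hpair : ∀ x ∈ Zmod C d p, ω p q x y₀ = 0) :
    y₀ ∈ Bmod C d q := by
  cases p with
  | zero =>
    rw [hnd₂ 0 q hpq y₀ fun a => hpair a trivial]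
    exact zero_mem _
  | succ p =>
    have hpq' : p + (q + 1) = n := by omega
    have hinj : Function.Injective (ω p (q + 1)) :=
      (injective_iff_map_eq_zero _).2 fun a ha => hnd₁ p (q + 1) hpq' a fun b => by simp [ha]
    have hsurj : Function.Surjective (ω p (q + 1)).flip :=
      LinearMap.flip_surjective_iff₁.2 hinj
    obtain ⟨g, hg⟩ : (ω (p + 1) q).flip y₀ ∈ LinearMap.range (d p).dualMap := by
      rw [LinearMap.range_dualMap_eq_dualAnnihilator_ker, Submodule.mem_dualAnnihilator]
      exact hpair
    obtain ⟨z, rfl⟩ := hsurj g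
    refine ⟨(-1 : ℝ) ^ (p + 1) • z, (sub_eq_zero.1 (hnd₂ (p + 1) q hpq _ fun a => ?_)).symm⟩
    have h := LinearMap.congr_fun hg a
    simp only [LinearMap.dualMap_apply, LinearMap.flip_apply] at h
    rw [map_sub, ← h, hcompat p q hpq', map_smul, map_smul, smul_eq_mul, sub_self]
end
end
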